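/- For every k ≥ 6 with k ≡ 2 (mod 4), there exists an almost resolvable k-cycle system of order 2k+1. -/

import Mathlib

/-- The set of edges of the closed walk `c 0, c 1, …, c (k-1), c 0`.
When `c` is injective, this is a cycle of length `k`. -/
def cycleEdgeSet {V : Type*} {k : ℕ} (c : ZMod k → V) : Set (Sym2 V) :=
  {e | ∃ i : ZMod k, e = s(c i, c (i + 1))}

/-- `HasARCS k v` asserts the existence of an almost resolvable `k`-cycle system of
order `v`: a collection of `k`-cycles whose edge sets partition the edge set of the
complete graph on `v` vertices, partitioned into `(v-1)/2` almost parallel classes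
(each consisting of `(v-1)/k` pairwise vertex-disjoint `k`-cycles) together with one
half-parallel class (consisting of `(v-1)/(2k)` pairwise vertex-disjoint `k`-cycles). -/
def HasARCS (k v : ℕ) : Prop :=
  ∃ (apc : Fin ((v - 1) / 2) → Fin ((v - 1) / k) → ZMod k → Fin v)
    (hpc : Fin ((v - 1) / (2 * k)) → ZMod k → Fin v),
    (∀ i j, Function.Injective (apc i j)) ∧
    (∀ j, Function.Injective (hpc j)) ∧
    (∀ i, ∀ j₁ j₂, j₁ ≠ j₂ →
      Disjoint (Set.range (apc i j₁)) (Set.range (apc i j₂))) ∧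
    (∀ j₁ j₂, j₁ ≠ j₂ → Disjoint (Set.range (hpc j₁)) (Set.range (hpc j₂))) ∧
    (∀ e : Sym2 (Fin v), ¬ e.IsDiag →
      ∃! p : (Fin ((v - 1) / 2) × Fin ((v - 1) / k)) ⊕ Fin ((v - 1) / (2 * k)),
        e ∈ Sum.elim (fun q => cycleEdgeSet (apc q.1 q.2))
              (fun j => cycleEdgeSet (hpc j)) p)

namespace ARCS

/-- Vertices: four copies of `ZMod (2m+1)` and a point at infinity. -/
abbrev VV (m : ℕ) := Option (Fin 4 × ZMod (2 * m + 1))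

/-- Periodic pattern: in block `a` the vertices are `(t₀, a + c₀), (t₁, -a + c₁),
`(t₂, a + c₂), (t₃, -a + c₃)`. -/
def pat (m : ℕ) (t₀ t₁ t₂ t₃ : Fin 4) (c₀ c₁ c₂ c₃ : ZMod (2 * m + 1)) (i : ℕ) : VV m :=
  if i % 4 = 0 then some (t₀, ((i / 4 : ℕ) : ZMod (2 * m + 1)) + c₀)
  else if i % 4 = 1 then some (t₁, -((i / 4 : ℕ) : ZMod (2 * m + 1)) + c₁)
  else if i % 4 = 2 then some (t₂, ((i / 4 : ℕ) : ZMod (2 * m + 1)) + c₂)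
  else some (t₃, -((i / 4 : ℕ) : ZMod (2 * m + 1)) + c₃)

/-- First cycle of the first base class. -/
def cA1 (m i : ℕ) : VV m :=
  if i = 0 then some (2, 1) else if i = 1 then some (1, -1) else if i = 2 then some (3, 0)
  else if i = 4 * m then some (1, -3 * (m + 1)) else if i = 4 * m + 1 then none
  else pat m 0 0 1 1 1 (-1) (-1) (-2) i

/-- Second cycle of the first base class. -/
def cA2 (m i : ℕ) : VV m :=
  if i = 4 * m then some (0, -1) else if i = 4 * m + 1 then some (0, 1)
  else pat m 2 2 3 3 2 0 (1 - (m + 1)) (-(m + 1)) i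

/-- First cycle of the second base class. -/
def cB1 (m i : ℕ) : VV m :=
  if i = 4 * m then some (2, 2) else if i = 4 * m + 1 then some (1, -2)
  else pat m 0 2 1 3 0 0 0 0 i

/-- Second cycle of the second base class. -/
def cB2 (m i : ℕ) : VV m :=
  if i + 3 = 4 * m then some (2, 1) else if i + 2 = 4 * m then some (3, -(m + 1))
  else if i + 1 = 4 * m then some (0, -(m + 1)) else if i = 4 * m then some (3, m + 1)
  else if i = 4 * m + 1 then none
  else pat m 0 3 1 2 (m + 1) (-3 * (m + 1)) (-(m + 1)) (m + 1) i

/-- The four base cycles. -/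
def base (m : ℕ) (c j : Fin 2) : ℕ → VV m :=
  if c = 0 then (if j = 0 then cA1 m else cA2 m) else (if j = 0 then cB1 m else cB2 m)

/-- Translation by `g`. -/
def sh (m : ℕ) (g : ZMod (2 * m + 1)) : VV m → VV m := Option.map (fun p => (p.1, p.2 + g))

/-- The half-parallel class cycle. -/
def hp (m i : ℕ) : VV m := some (if i % 2 = 0 then 0 else 1, ((i / 2 : ℕ) : ZMod (2 * m + 1)))

/-- `u`, `v` are consecutive on a base cycle. -/
def Cons (m : ℕ) (u v : VV m) : Prop :=
  ∃ (c j : Fin 2) (i : ℕ), i < 4 * m + 2 ∧ base m c j i = u ∧ base m c j ((i + 1) % (4 * m + 2)) = v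

/-- `d` occurs as a difference of type `(s,t)` in the base cycles. -/
def Dif (m : ℕ) (s t : Fin 4) (d : ZMod (2 * m + 1)) : Prop :=
  ∃ x, Cons m (some (s, x)) (some (t, x + d)) ∨ Cons m (some (t, x + d)) (some (s, x))

lemma Dif.mk {m : ℕ} {s t : Fin 4} {x y d : ZMod (2 * m + 1)} 
    (h : Cons m (some (s, x)) (some (t, y))) (hd : y = x + d) : Dif m s t d := by
  subst hd; exact ⟨x, Or.inl h⟩

lemma Dif.symm' {m : ℕ} {s t : Fin 4} {d e : ZMod (2 * m + 1)} (h : Dif m s t d) (he : e = -d) :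
    Dif m t s e := by
  subst he
  obtain ⟨x, h | h⟩ := h
  · exact ⟨x + d, Or.inr (by simpa using h)⟩
  · exact ⟨x + d, Or.inl (by simpa using h)⟩

lemma Dif.cast {m : ℕ} {s t : Fin 4} {d e : ZMod (2 * m + 1)} (h : Dif m s t d) (he : e = d) :
    Dif m s t e := he ▸ h

lemma pat0 {m : ℕ} {t₀ t₁ t₂ t₃ : Fin 4} {c₀ c₁ c₂ c₃ : ZMod (2 * m + 1)} (a : ℕ) :
    pat m t₀ t₁ t₂ t₃ c₀ c₁ c₂ c₃ (4 * a) = some (t₀, (a : ZMod (2 * m + 1)) + c₀) := by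
  have h : 4 * a / 4 = a := by omega
  unfold pat; rw [if_pos (by omega), h]

lemma pat1 {m : ℕ} {t₀ t₁ t₂ t₃ : Fin 4} {c₀ c₁ c₂ c₃ : ZMod (2 * m + 1)} (a : ℕ) :
    pat m t₀ t₁ t₂ t₃ c₀ c₁ c₂ c₃ (4 * a + 1) = some (t₁, -(a : ZMod (2 * m + 1)) + c₁) := by
  have h : (4 * a + 1) / 4 = a := by omega
  unfold pat; rw [if_neg (by omega), if_pos (by omega), h]

lemma pat2 {m : ℕ} {t₀ t₁ t₂ t₃ : Fin 4} {c₀ c₁ c₂ c₃ : ZMod (2 * m + 1)} (a : ℕ) :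
    pat m t₀ t₁ t₂ t₃ c₀ c₁ c₂ c₃ (4 * a + 2) = some (t₂, (a : ZMod (2 * m + 1)) + c₂) := by
  have h : (4 * a + 2) / 4 = a := by omega
  unfold pat; rw [if_neg (by omega), if_neg (by omega), if_pos (by omega), h]

lemma pat3 {m : ℕ} {t₀ t₁ t₂ t₃ : Fin 4} {c₀ c₁ c₂ c₃ : ZMod (2 * m + 1)} (a : ℕ) :
    pat m t₀ t₁ t₂ t₃ c₀ c₁ c₂ c₃ (4 * a + 3) = some (t₃, -(a : ZMod (2 * m + 1)) + c₃) := by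
  have h : (4 * a + 3) / 4 = a := by omega
  unfold pat; rw [if_neg (by omega), if_neg (by omega), if_neg (by omega), h]

/-! Values of the base cycles. -/

lemma cA1_pat {m i : ℕ} (h1 : 3 ≤ i) (h2 : i < 4 * m) :
    base m 0 0 i = pat m 0 0 1 1 1 (-1) (-1) (-2) i := by
  simp only [base, if_true, cA1]
  rw [if_neg (by omega), if_neg (by omega), if_neg (by omega), if_neg (by omega),
    if_neg (by omega)]

lemma cA2_pat {m i : ℕ} (h2 : i < 4 * m) :
    base m 0 1 i = pat m 2 2 3 3 2 0 (1 - (m + 1)) (-(m + 1)) i := by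
  simp only [base, if_true, one_ne_zero, if_false, cA2]
  rw [if_neg (by omega), if_neg (by omega)]

lemma cB1_pat {m i : ℕ} (h2 : i < 4 * m) :
    base m 1 0 i = pat m 0 2 1 3 0 0 0 0 i := by
  simp only [base, if_true, one_ne_zero, if_false, cB1]
  rw [if_neg (by omega), if_neg (by omega)]

lemma cB2_pat {m i : ℕ} (h2 : i + 3 < 4 * m) :
    base m 1 1 i = pat m 0 3 1 2 (m + 1) (-3 * (m + 1)) (-(m + 1)) (m + 1) i := by
  simp only [base, one_ne_zero, if_false, cB2]
  rw [if_neg (by omega), if_neg (by omega), if_neg (by omega), if_neg (by omega),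
    if_neg (by omega)]

lemma A1_0 (m : ℕ) : base m 0 0 0 = some (2, 1) := by simp [base, cA1]
lemma A1_1 (m : ℕ) : base m 0 0 1 = some (1, -1) := by simp [base, cA1]
lemma A1_2 (m : ℕ) : base m 0 0 2 = some (3, 0) := by simp [base, cA1]
lemma A1_e (m : ℕ) (hm : 1 ≤ m) : base m 0 0 (4 * m) = some (1, -3 * ((m : ZMod (2 * m + 1)) + 1)) := by
  simp only [base, if_true, cA1]
  rw [if_neg (by omega), if_neg (by omega), if_neg (by omega)]
lemma A1_f (m : ℕ) (hm : 1 ≤ m) : base m 0 0 (4 * m + 1) = none := by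
  simp only [base, if_true, cA1]
  rw [if_neg (by omega), if_neg (by omega), if_neg (by omega), if_neg (by omega)]
lemma A2_e (m : ℕ) : base m 0 1 (4 * m) = some (0, -1) := by simp [base, cA2]
lemma A2_f (m : ℕ) : base m 0 1 (4 * m + 1) = some (0, 1) := by simp [base, cA2]
lemma B1_e (m : ℕ) : base m 1 0 (4 * m) = some (2, 2) := by simp [base, cB1]
lemma B1_f (m : ℕ) : base m 1 0 (4 * m + 1) = some (1, -2) := by simp [base, cB1]
lemma B2_b (m : ℕ) : base (m + 1) 1 1 (4 * m + 1) = some (2, 1) := by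
  simp only [base, one_ne_zero, if_false, cB2]
  rw [if_pos (by omega)]
lemma B2_c (m : ℕ) : base (m + 1) 1 1 (4 * m + 2) = some (3, -(((m + 1 : ℕ) : ZMod _) + 1)) := by
  simp only [base, one_ne_zero, if_false, cB2]
  rw [if_neg (by omega), if_pos (by omega)]
lemma B2_d (m : ℕ) : base (m + 1) 1 1 (4 * m + 3) = some (0, -(((m + 1 : ℕ) : ZMod _) + 1)) := by
  simp only [base, one_ne_zero, if_false, cB2]
  rw [if_neg (by omega), if_neg (by omega), if_pos (by omega)]
lemma B2_e (m : ℕ) : base (m + 1) 1 1 (4 * m + 4) = some (3, ((m + 1 : ℕ) : ZMod _) + 1) := by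
  simp only [base, one_ne_zero, if_false, cB2]
  rw [if_neg (by omega), if_neg (by omega), if_neg (by omega), if_pos (by omega)]
lemma B2_f (m : ℕ) : base (m + 1) 1 1 (4 * m + 5) = none := by
  simp only [base, one_ne_zero, if_false, cB2]
  rw [if_neg (by omega), if_neg (by omega), if_neg (by omega), if_neg (by omega),
    if_pos (by omega)]

lemma Cons.mk {m : ℕ} (c j : Fin 2) (i : ℕ) {u v : VV m} (hi : i + 1 < 4 * m + 2)
    (h1 : base m c j i = u) (h2 : base m c j (i + 1) = v) : Cons m u v :=
  ⟨c, j, i, by omega, h1, by rwa [Nat.mod_eq_of_lt hi]⟩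

lemma Cons.last {m : ℕ} (c j : Fin 2) {u v : VV m}
    (h1 : base m c j (4 * m + 1) = u) (h2 : base m c j 0 = v) : Cons m u v :=
  ⟨c, j, 4 * m + 1, by omega, h1, by rwa [Nat.mod_self]⟩

lemma hn (m : ℕ) : (2 * m + 1 : ZMod (2 * m + 1)) = 0 := by
  have := ZMod.natCast_self (2 * m + 1)
  push_cast at this; exact this

lemma rep (m : ℕ) (d : ZMod (2 * m + 1)) :
    (∃ b : ℕ, b ≤ m ∧ d = 2 * (b : ZMod (2 * m + 1))) ∨
    (∃ b : ℕ, b < m ∧ d = 2 * (b : ZMod (2 * m + 1)) + 1) := by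
  have h1 := ZMod.val_lt d
  have h2 := ZMod.natCast_zmod_val d
  rcases Nat.even_or_odd' d.val with ⟨b, hb | hb⟩
  · left; refine ⟨b, by omega, ?_⟩
    rw [← h2, hb]; push_cast; rfl
  · right; refine ⟨b, by omega, ?_⟩
    rw [← h2, hb]; push_cast; rfl

lemma rep' (m : ℕ) (d : ZMod (2 * m + 1)) :
    (∃ b : ℕ, b ≤ m ∧ d = (b : ZMod (2 * m + 1))) ∨
    (∃ b : ℕ, 1 ≤ b ∧ b ≤ m ∧ d = -(b : ZMod (2 * m + 1))) := by
  have h1 := ZMod.val_lt d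
  have h2 := ZMod.natCast_zmod_val d
  by_cases h : d.val ≤ m
  · left; exact ⟨d.val, h, h2.symm⟩
  · right; refine ⟨2 * m + 1 - d.val, by omega, by omega, ?_⟩
    rw [Nat.cast_sub (by omega), h2]; push_cast; linear_combination hn m

/-! Differences. -/

lemma d00 (m a : ℕ) (h : a < m) : Dif m 0 0 (-(2 * a + 2)) := by
  rcases Nat.eq_zero_or_pos a with rfl | h0
  · refine Dif.symm' (Dif.mk (Cons.mk 0 1 (4 * m) (by omega) (A2_e m) (A2_f m))
      (d := 2) (by ring)) (by push_cast; ring)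
  · exact Dif.mk (Cons.mk 0 0 (4 * a) (by omega) ((cA1_pat (by omega) (by omega)).trans (pat0 a))
      ((cA1_pat (by omega) (by omega)).trans (pat1 a))) (by ring)

lemma d11 (m a : ℕ) (h : a < m) : Dif m 1 1 (-(2 * a + 1)) := by
  rcases Nat.eq_zero_or_pos a with rfl | h0
  · obtain ⟨l, rfl⟩ : ∃ l, m = l + 1 := ⟨m - 1, by omega⟩
    refine Dif.mk (Cons.mk 0 0 (4 * l + 3) (by omega)
      ((cA1_pat (by omega) (by omega)).trans (pat3 l)) (A1_e (l + 1) (by omega))) ?_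
    have := hn (l + 1)
    push_cast at this ⊢; linear_combination -this
  · exact Dif.mk (Cons.mk 0 0 (4 * a + 2) (by omega)
      ((cA1_pat (by omega) (by omega)).trans (pat2 a))
      ((cA1_pat (by omega) (by omega)).trans (pat3 a))) (by ring)

lemma d22 (m a : ℕ) (h : a < m) : Dif m 2 2 (-(2 * a + 2)) :=
  Dif.mk (Cons.mk 0 1 (4 * a) (by omega) ((cA2_pat (by omega)).trans (pat0 a))
    ((cA2_pat (by omega)).trans (pat1 a))) (by ring)

lemma d33 (m a : ℕ) (h : a < m) : Dif m 3 3 (-(2 * a + 1)) :=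
  Dif.mk (Cons.mk 0 1 (4 * a + 2) (by omega) ((cA2_pat (by omega)).trans (pat2 a))
    ((cA2_pat (by omega)).trans (pat3 a))) (by ring)

lemma pure_even (m : ℕ) (s : Fin 4) (H : ∀ a : ℕ, a < m → Dif m s s (-(2 * a + 2)))
    (d : ZMod (2 * m + 1)) (hd : d ≠ 0) : Dif m s s d := by
  rcases rep m d with ⟨b, hb, rfl⟩ | ⟨b, hb, rfl⟩
  · have : b ≠ 0 := by rintro rfl; simp at hd
    obtain ⟨a, rfl⟩ : ∃ a, b = a + 1 := ⟨b - 1, by omega⟩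
    exact (H a (by omega)).symm' (by push_cast; ring)
  · refine (H (m - b - 1) (by omega)).cast ?_
    rw [Nat.cast_sub (by omega), Nat.cast_sub (by omega)]
    push_cast; linear_combination hn m

lemma pure_odd (m : ℕ) (s : Fin 4) (H : ∀ a : ℕ, a < m → Dif m s s (-(2 * a + 1)))
    (d : ZMod (2 * m + 1)) (hd : d ≠ 0) : Dif m s s d := by
  rcases rep m d with ⟨b, hb, rfl⟩ | ⟨b, hb, rfl⟩
  · have : b ≠ 0 := by rintro rfl; simp at hd
    refine (H (m - b) (by omega)).cast ?_
    rw [Nat.cast_sub (by omega)]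
    linear_combination hn m
  · exact (H b (by omega)).symm' (by ring)

lemma d01 (m : ℕ) (hm : 1 ≤ m) (d : ZMod (2 * m + 1)) : Dif m 0 1 d ∨ d = 0 ∨ d = -1 := by
  have hn := hn m
  rcases rep m d with ⟨b, hb, rfl⟩ | ⟨b, hb, rfl⟩
  · rcases Nat.eq_zero_or_pos b with rfl | h0
    · right; left; simp
    rcases Nat.lt_or_ge b m with h1 | h1
    · left
      exact Dif.mk (Cons.mk 0 0 (4 * b + 1) (by omega)
        ((cA1_pat (by omega) (by omega)).trans (pat1 b))
        ((cA1_pat (by omega) (by omega)).trans (pat2 b))) (by ring)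
    · right; right
      obtain rfl : b = m := by omega
      linear_combination hn
  · left
    by_cases h : b + 1 = m
    · refine (Dif.mk (Cons.last 1 0 (B1_f m) ((cB1_pat (by omega)).trans (pat0 0)))
        (d := 2) (by simp)).symm' ?_
      have : (b : ZMod (2 * m + 1)) + 1 = m := by exact_mod_cast congrArg _ h
      linear_combination hn + 2 * this
    · obtain ⟨a, rfl⟩ : ∃ a, m = a + b + 2 := ⟨m - b - 2, by omega⟩
      refine (Dif.mk (Cons.mk 0 0 (4 * a + 3) (by omega)
        ((cA1_pat (by omega) (by omega)).trans (pat3 a))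
        ((cA1_pat (by omega) (by omega)).trans (pat0 (a + 1)))) (d := 2 * a + 4) ?_).symm' ?_
      · push_cast; ring
      · push_cast at hn ⊢; linear_combination hn

lemma d02 (m : ℕ) (hm : 1 ≤ m) (d : ZMod (2 * m + 1)) : Dif m 0 2 d := by
  have hn := hn m
  obtain ⟨e, rfl⟩ : ∃ e, d = -e := ⟨-d, by ring⟩
  rcases rep m e with ⟨b, hb, rfl⟩ | ⟨b, hb, rfl⟩
  · rcases Nat.lt_or_ge b m with h1 | h1
    · exact Dif.mk (Cons.mk 1 0 (4 * b) (by omega)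
        ((cB1_pat (by omega)).trans (pat0 b)) ((cB1_pat (by omega)).trans (pat1 b))) (by ring)
    · obtain rfl : b = m := by omega
      refine Dif.mk (Cons.last 0 1 (A2_f b) ((cA2_pat (by omega)).trans (pat0 0))) ?_
      push_cast; linear_combination hn
  · by_cases h : b + 1 = m
    · subst h
      refine Dif.mk (Cons.mk 1 1 (4 * b) (by omega)
        ((cB2_pat (by omega)).trans (pat0 b)) (B2_b b)) ?_
      push_cast at hn ⊢; ring
    · refine (Dif.mk (Cons.mk 1 1 (4 * b + 3) (by omega)
        ((cB2_pat (by omega)).trans (pat3 b))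
        ((cB2_pat (by omega)).trans (pat0 (b + 1)))) (d := 2 * b + 1) ?_).symm' rfl
      push_cast; ring

lemma d03 (m : ℕ) (hm : 1 ≤ m) (d : ZMod (2 * m + 1)) : Dif m 0 3 d := by
  have hn := hn m
  obtain ⟨e, rfl⟩ : ∃ e, d = -e := ⟨-d, by ring⟩
  obtain ⟨l, rfl⟩ : ∃ l, m = l + 1 := ⟨m - 1, by omega⟩
  rcases rep _ e with ⟨b, hb, rfl⟩ | ⟨b, hb, rfl⟩
  · rcases Nat.eq_zero_or_pos b with rfl | h0
    · exact (Dif.mk (Cons.mk 1 1 (4 * l + 2) (by omega) (B2_c l) (B2_d l))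
        (d := 0) (by ring)).symm' (by simp)
    rcases Nat.lt_or_ge b (l + 1) with h1 | h1
    · obtain ⟨a, rfl⟩ : ∃ a, b = a + 1 := ⟨b - 1, by omega⟩
      refine Dif.mk (Cons.mk 1 1 (4 * a) (by omega)
        ((cB2_pat (by omega)).trans (pat0 a)) ((cB2_pat (by omega)).trans (pat1 a))) ?_
      push_cast at hn ⊢; linear_combination -2 * hn
    · obtain rfl : b = l + 1 := by omega
      refine Dif.mk (Cons.mk 1 1 (4 * l + 3) (by omega) (B2_d l) (B2_e l)) ?_
      push_cast at hn ⊢; linear_combination 2 * hn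
  · by_cases h : b = l
    · subst h
      refine (Dif.mk (Cons.mk 0 1 (4 * b + 3) (by omega)
        ((cA2_pat (by omega)).trans (pat3 b)) (A2_e (b + 1))) (d := 2 * b + 1) ?_).symm' rfl
      push_cast at hn ⊢; ring
    · refine (Dif.mk (Cons.mk 1 0 (4 * b + 3) (by omega)
        ((cB1_pat (by omega)).trans (pat3 b))
        ((cB1_pat (by omega)).trans (pat0 (b + 1)))) (d := 2 * b + 1) ?_).symm' rfl
      push_cast; ring

lemma d21 (m : ℕ) (hm : 1 ≤ m) (d : ZMod (2 * m + 1)) : Dif m 2 1 d := by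
  have hn := hn m
  rcases rep m d with ⟨b, hb, rfl⟩ | ⟨b, hb, rfl⟩
  · rcases Nat.lt_or_ge b m with h1 | h1
    · exact Dif.mk (Cons.mk 1 0 (4 * b + 1) (by omega)
        ((cB1_pat (by omega)).trans (pat1 b)) ((cB1_pat (by omega)).trans (pat2 b))) (by ring)
    · obtain rfl : b = m := by omega
      by_cases hb1 : b = 1
      · subst hb1
        refine Dif.mk (Cons.mk 1 0 (4 * 1) (by omega) (B1_e 1) (B1_f 1)) ?_
        push_cast at hn ⊢; linear_combination -2 * hn
      · refine (Dif.mk (Cons.mk 1 1 (4 * 0 + 2) (by omega)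
          ((cB2_pat (by omega)).trans (pat2 0)) ((cB2_pat (by omega)).trans (pat3 0)))
          (d := 1) ?_).symm' ?_
        · push_cast; linear_combination hn
        · linear_combination hn
  · by_cases h : b + 1 = m
    · subst h
      refine Dif.mk (Cons.mk 0 0 0 (by omega) (A1_0 _) (A1_1 _)) ?_
      push_cast at hn ⊢; linear_combination -hn
    by_cases h : b + 2 = m
    · subst h
      refine Dif.mk (Cons.mk 1 0 (4 * (b + 2)) (by omega) (B1_e _) (B1_f _)) ?_
      push_cast at hn ⊢; linear_combination -hn
    · refine (Dif.mk (Cons.mk 1 1 (4 * (b + 1) + 2) (by omega)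
          ((cB2_pat (by omega)).trans (pat2 (b + 1))) ((cB2_pat (by omega)).trans (pat3 (b + 1))))
          (d := -(2 * b + 1)) ?_).symm' (by ring)
      push_cast; linear_combination hn

lemma d13 (m : ℕ) (hm : 1 ≤ m) (d : ZMod (2 * m + 1)) : Dif m 1 3 d := by
  have hn := hn m
  obtain ⟨e, rfl⟩ : ∃ e, d = -e := ⟨-d, by ring⟩
  rcases rep m e with ⟨b, hb, rfl⟩ | ⟨b, hb, rfl⟩
  · rcases Nat.lt_or_ge b m with h1 | h1
    · exact Dif.mk (Cons.mk 1 0 (4 * b + 2) (by omega)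
        ((cB1_pat (by omega)).trans (pat2 b)) ((cB1_pat (by omega)).trans (pat3 b))) (by ring)
    · obtain rfl : b = m := by omega
      refine Dif.mk (Cons.mk 0 0 1 (by omega) (A1_1 _) (A1_2 _)) ?_
      linear_combination hn
  · by_cases h : b + 1 = m
    · subst h
      refine (Dif.mk (Cons.mk 0 0 2 (by omega) (A1_2 _)
        ((cA1_pat (by omega) (by omega)).trans (pat3 0))) (d := 2 * b + 1) ?_).symm' rfl
      push_cast at hn ⊢; linear_combination -hn
    · refine (Dif.mk (Cons.mk 1 1 (4 * b + 1) (by omega)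
        ((cB2_pat (by omega)).trans (pat1 b))
        ((cB2_pat (by omega)).trans (pat2 b))) (d := 2 * b + 1) ?_).symm' rfl
      linear_combination hn

lemma d23 (m : ℕ) (hm : 1 ≤ m) (d : ZMod (2 * m + 1)) : Dif m 2 3 d := by
  have hn := hn m
  obtain ⟨e, rfl⟩ : ∃ e, d = e - (m + 1) := ⟨d + (m + 1), by ring⟩
  rcases rep m e with ⟨b, hb, rfl⟩ | ⟨b, hb, rfl⟩
  · obtain ⟨l, rfl⟩ : ∃ l, m = l + 1 := ⟨m - 1, by omega⟩
    rcases Nat.eq_zero_or_pos b with rfl | h0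
    · refine (Dif.mk (Cons.mk 1 0 (4 * l + 3) (by omega)
        ((cB1_pat (by omega)).trans (pat3 l)) (B1_e (l + 1))) (d := l + 2) (by ring)).symm' ?_
      push_cast; ring
    rcases Nat.lt_or_ge b (l + 1) with h1 | h1
    · obtain ⟨a, rfl⟩ : ∃ a, l = a + b := ⟨l - b, by omega⟩
      refine (Dif.mk (Cons.mk 0 1 (4 * a + 3) (by omega)
        ((cA2_pat (by omega)).trans (pat3 a))
        ((cA2_pat (by omega)).trans (pat0 (a + 1))))
        (d := 2 * a + 3 + (a + b + 2)) ?_).symm' ?_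
      · push_cast; ring
      · push_cast at hn ⊢; linear_combination hn
    · obtain rfl : b = l + 1 := by omega
      refine Dif.mk (Cons.mk 1 1 (4 * l + 1) (by omega) (B2_b l) (B2_c l)) ?_
      push_cast at hn ⊢; linear_combination -hn
  · refine Dif.mk (Cons.mk 0 1 (4 * b + 1) (by omega)
        ((cA2_pat (by omega)).trans (pat1 b)) ((cA2_pat (by omega)).trans (pat2 b))) ?_
    ring


/-! Vertices. -/

/-- `v` lies on one of the two cycles of base class `c`. -/
def Hit (m : ℕ) (c : Fin 2) (v : VV m) : Prop :=
  ∃ (j : Fin 2) (i : ℕ), i < 4 * m + 2 ∧ base m c j i = v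

lemma Hit.mk {m : ℕ} {c : Fin 2} (j : Fin 2) (i : ℕ) {s : Fin 4} {x y : ZMod (2 * m + 1)}
    (h : base m c j i = some (s, y)) (hi : i < 4 * m + 2) (hx : x = y) :
    Hit m c (some (s, x)) := ⟨j, i, hi, by rw [h, hx]⟩

lemma hitA0 (m : ℕ) (hm : 1 ≤ m) (x : ZMod (2 * m + 1)) (hx : x ≠ 0) :
    Hit m 0 (some (0, x)) := by
  rcases rep' m x with ⟨b, hb, rfl⟩ | ⟨b, hb1, hb, rfl⟩
  · have : b ≠ 0 := by rintro rfl; simp at hx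
    by_cases h1 : b = 1
    · subst h1
      exact Hit.mk 1 (4 * m + 1) (A2_f m) (by omega) (by simp)
    · obtain ⟨a, rfl⟩ : ∃ a, b = a + 1 := ⟨b - 1, by omega⟩
      exact Hit.mk 0 (4 * a) ((cA1_pat (by omega) (by omega)).trans (pat0 a)) (by omega)
        (by push_cast; ring)
  · by_cases h1 : b = 1
    · subst h1
      exact Hit.mk 1 (4 * m) (A2_e m) (by omega) (by simp)
    · obtain ⟨a, rfl⟩ : ∃ a, b = a + 1 := ⟨b - 1, by omega⟩
      exact Hit.mk 0 (4 * a + 1) ((cA1_pat (by omega) (by omega)).trans (pat1 a)) (by omega)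
        (by push_cast; ring)

lemma hitA1 (m : ℕ) (hm : 1 ≤ m) (x : ZMod (2 * m + 1)) : Hit m 0 (some (1, x)) := by
  have hn := hn m
  rcases rep' m x with ⟨b, hb, rfl⟩ | ⟨b, hb1, hb, rfl⟩
  · by_cases h1 : b = m
    · obtain ⟨a, rfl⟩ : ∃ a, b = a + 1 := ⟨b - 1, by omega⟩
      subst h1
      refine Hit.mk 0 (4 * a + 3) ((cA1_pat (by omega) (by omega)).trans (pat3 a)) (by omega) ?_
      push_cast at hn ⊢; linear_combination hn
    by_cases h2 : b + 1 = m
    · subst h2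
      refine Hit.mk 0 (4 * (b + 1)) (A1_e _ (by omega)) (by omega) ?_
      push_cast at hn ⊢; linear_combination 2 * hn
    · refine Hit.mk 0 (4 * (b + 1) + 2) ((cA1_pat (by omega) (by omega)).trans (pat2 (b + 1)))
        (by omega) ?_
      push_cast; ring
  · by_cases h1 : b = 1
    · subst h1
      exact Hit.mk 0 1 (A1_1 m) (by omega) (by simp)
    · obtain ⟨a, rfl⟩ : ∃ a, b = a + 2 := ⟨b - 2, by omega⟩
      refine Hit.mk 0 (4 * a + 3) ((cA1_pat (by omega) (by omega)).trans (pat3 a)) (by omega) ?_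
      push_cast; ring

lemma hitA2 (m : ℕ) (hm : 1 ≤ m) (x : ZMod (2 * m + 1)) : Hit m 0 (some (2, x)) := by
  have hn := hn m
  rcases rep' m x with ⟨b, hb, rfl⟩ | ⟨b, hb1, hb, rfl⟩
  · by_cases h0 : b = 0
    · subst h0
      exact Hit.mk 1 (4 * 0 + 1) ((cA2_pat (by omega)).trans (pat1 0)) (by omega) (by simp)
    by_cases h1 : b = 1
    · subst h1
      exact Hit.mk 0 0 (A1_0 m) (by omega) (by simp)
    · obtain ⟨a, rfl⟩ : ∃ a, b = a + 2 := ⟨b - 2, by omega⟩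
      refine Hit.mk 1 (4 * a) ((cA2_pat (by omega)).trans (pat0 a)) (by omega) ?_
      push_cast; ring
  · by_cases h1 : b = m
    · obtain ⟨a, rfl⟩ : ∃ a, b = a + 1 := ⟨b - 1, by omega⟩
      subst h1
      refine Hit.mk 1 (4 * a) ((cA2_pat (by omega)).trans (pat0 a)) (by omega) ?_
      push_cast at hn ⊢; linear_combination -hn
    · exact Hit.mk 1 (4 * b + 1) ((cA2_pat (by omega)).trans (pat1 b)) (by omega) (by ring)

lemma hitA3 (m : ℕ) (hm : 1 ≤ m) (x : ZMod (2 * m + 1)) : Hit m 0 (some (3, x)) := by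
  have hn := hn m
  obtain ⟨y, rfl⟩ : ∃ y, x = y - (m + 1) := ⟨x + (m + 1), by ring⟩
  rcases rep' m y with ⟨b, hb, rfl⟩ | ⟨b, hb1, hb, rfl⟩
  · by_cases h0 : b = 0
    · subst h0
      exact Hit.mk 1 (4 * 0 + 3) ((cA2_pat (by omega)).trans (pat3 0)) (by omega) (by simp)
    · obtain ⟨a, rfl⟩ : ∃ a, b = a + 1 := ⟨b - 1, by omega⟩
      refine Hit.mk 1 (4 * a + 2) ((cA2_pat (by omega)).trans (pat2 a)) (by omega) ?_
      push_cast; ring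
  · by_cases h1 : b = m
    · subst h1
      refine Hit.mk 0 2 (A1_2 _) (by omega) ?_
      linear_combination -hn
    · exact Hit.mk 1 (4 * b + 3) ((cA2_pat (by omega)).trans (pat3 b)) (by omega) (by ring)

lemma hitB0 (m : ℕ) (hm : 1 ≤ m) (x : ZMod (2 * m + 1)) : Hit m 1 (some (0, x)) := by
  have hn := hn m
  obtain ⟨l, rfl⟩ : ∃ l, m = l + 1 := ⟨m - 1, by omega⟩
  rcases rep' _ x with ⟨b, hb, rfl⟩ | ⟨b, hb1, hb, rfl⟩
  · by_cases h1 : b = l + 1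
    · subst h1
      refine Hit.mk 1 (4 * l + 3) (B2_d l) (by omega) ?_
      push_cast at hn ⊢; linear_combination hn
    · exact Hit.mk 0 (4 * b) ((cB1_pat (by omega)).trans (pat0 b)) (by omega) (by ring)
  · obtain ⟨a, ha⟩ : ∃ a, l + 1 = a + b := ⟨l + 1 - b, by omega⟩
    have ha' : (l : ZMod (2 * (l + 1) + 1)) + 1 = a + b := by exact_mod_cast congrArg _ ha
    refine Hit.mk 1 (4 * a) ((cB2_pat (by omega)).trans (pat0 a)) (by omega) ?_
    push_cast at hn ⊢; linear_combination -hn + ha'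

lemma hitB1 (m : ℕ) (hm : 1 ≤ m) (x : ZMod (2 * m + 1)) (hx : x ≠ -1) :
    Hit m 1 (some (1, x)) := by
  have hn := hn m
  rcases rep' _ x with ⟨b, hb, rfl⟩ | ⟨b, hb1, hb, rfl⟩
  · by_cases h1 : b = m
    · subst h1
      by_cases h2 : b = 1
      · subst h2
        refine Hit.mk 0 (4 * 1 + 1) (B1_f 1) (by omega) ?_
        push_cast at hn ⊢; linear_combination hn
      · refine Hit.mk 1 (4 * 0 + 2) ((cB2_pat (by omega)).trans (pat2 0)) (by omega) ?_
        push_cast; linear_combination hn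
    · exact Hit.mk 0 (4 * b + 2) ((cB1_pat (by omega)).trans (pat2 b)) (by omega) (by ring)
  · by_cases h1 : b = 1
    · subst h1; simp at hx
    by_cases h2 : b = 2
    · subst h2
      exact Hit.mk 0 (4 * m + 1) (B1_f m) (by omega) (by simp)
    · obtain ⟨a, ha⟩ : ∃ a, m + 1 = a + b := ⟨m + 1 - b, by omega⟩
      have ha' : (m : ZMod (2 * m + 1)) + 1 = a + b := by exact_mod_cast congrArg _ ha
      refine Hit.mk 1 (4 * a + 2) ((cB2_pat (by omega)).trans (pat2 a)) (by omega) ?_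
      linear_combination ha'

lemma hitB2 (m : ℕ) (hm : 1 ≤ m) (x : ZMod (2 * m + 1)) : Hit m 1 (some (2, x)) := by
  have hn := hn m
  rcases rep' _ x with ⟨b, hb, rfl⟩ | ⟨b, hb1, hb, rfl⟩
  · by_cases h0 : b = 0
    · subst h0
      exact Hit.mk 0 (4 * 0 + 1) ((cB1_pat (by omega)).trans (pat1 0)) (by omega) (by simp)
    by_cases h1 : b = 1
    · subst h1
      obtain ⟨l, rfl⟩ : ∃ l, m = l + 1 := ⟨m - 1, by omega⟩
      exact Hit.mk 1 (4 * l + 1) (B2_b l) (by omega) (by simp)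
    by_cases h2 : b = 2
    · subst h2
      exact Hit.mk 0 (4 * m) (B1_e m) (by omega) (by simp)
    · obtain ⟨a, ha⟩ : ∃ a, m + 1 = a + b := ⟨m + 1 - b, by omega⟩
      have ha' : (m : ZMod (2 * m + 1)) + 1 = a + b := by exact_mod_cast congrArg _ ha
      refine Hit.mk 1 (4 * a + 3) ((cB2_pat (by omega)).trans (pat3 a)) (by omega) ?_
      linear_combination -ha'
  · by_cases h1 : b = m
    · subst h1
      by_cases h2 : b = 1
      · subst h2
        refine Hit.mk 0 (4 * 1) (B1_e 1) (by omega) ?_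
        push_cast at hn ⊢; linear_combination -hn
      · refine Hit.mk 1 (4 * 0 + 3) ((cB2_pat (by omega)).trans (pat3 0)) (by omega) ?_
        push_cast; linear_combination -hn
    · exact Hit.mk 0 (4 * b + 1) ((cB1_pat (by omega)).trans (pat1 b)) (by omega) (by ring)

lemma hitB3 (m : ℕ) (hm : 1 ≤ m) (x : ZMod (2 * m + 1)) : Hit m 1 (some (3, x)) := by
  have hn := hn m
  obtain ⟨l, rfl⟩ : ∃ l, m = l + 1 := ⟨m - 1, by omega⟩
  rcases rep' _ x with ⟨b, hb, rfl⟩ | ⟨b, hb1, hb, rfl⟩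
  · by_cases h0 : b = 0
    · subst h0
      exact Hit.mk 0 (4 * 0 + 3) ((cB1_pat (by omega)).trans (pat3 0)) (by omega) (by simp)
    by_cases h1 : b = l + 1
    · subst h1
      refine Hit.mk 1 (4 * l + 2) (B2_c l) (by omega) ?_
      push_cast at hn ⊢; linear_combination hn
    · obtain ⟨a, ha⟩ : ∃ a, l = a + b := ⟨l - b, by omega⟩
      have ha' : (l : ZMod (2 * (l + 1) + 1)) = a + b := by exact_mod_cast congrArg _ ha
      refine Hit.mk 1 (4 * a + 1) ((cB2_pat (by omega)).trans (pat1 a)) (by omega) ?_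
      push_cast at hn ⊢; linear_combination 2 * hn - ha'
  · by_cases h1 : b = l + 1
    · subst h1
      refine Hit.mk 1 (4 * l + 4) (B2_e l) (by omega) ?_
      push_cast at hn ⊢; linear_combination -hn
    · exact Hit.mk 0 (4 * b + 3) ((cB1_pat (by omega)).trans (pat3 b)) (by omega) (by ring)

/-- The vertex missed by base class `c`. -/
def miss (m : ℕ) (c : Fin 2) : VV m := if c = 0 then some (0, 0) else some (1, -1)

lemma hit_all (m : ℕ) (hm : 1 ≤ m) (c : Fin 2) (v : VV m) (hv : v ≠ miss m c) : Hit m c v := by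
  obtain ⟨l, rfl⟩ : ∃ l, m = l + 1 := ⟨m - 1, by omega⟩
  rcases v with _ | ⟨s, x⟩
  · fin_cases c
    · exact ⟨0, 4 * (l + 1) + 1, by omega, A1_f _ hm⟩
    · exact ⟨1, 4 * l + 5, by omega, B2_f l⟩
  · fin_cases c <;> fin_cases s
    · exact hitA0 _ hm x (by rintro rfl; simp [miss] at hv)
    · exact hitA1 _ hm x
    · exact hitA2 _ hm x
    · exact hitA3 _ hm x
    · exact hitB0 _ hm x
    · exact hitB1 _ hm x (by rintro rfl; simp [miss] at hv)
    · exact hitB2 _ hm x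
    · exact hitB3 _ hm x

/-- All edges are covered. -/
lemma dif_all (m : ℕ) (hm : 1 ≤ m) (s t : Fin 4) (d : ZMod (2 * m + 1)) (h : s = t → d ≠ 0) :
    Dif m s t d ∨ (s = 0 ∧ t = 1 ∧ (d = 0 ∨ d = -1)) ∨ (s = 1 ∧ t = 0 ∧ (d = 0 ∨ d = 1)) := by
  fin_cases s <;> fin_cases t
  · exact Or.inl (pure_even m 0 (d00 m) d (h rfl))
  · rcases d01 m hm d with h | h
    · exact Or.inl h
    · exact Or.inr (Or.inl ⟨rfl, rfl, h⟩)
  · exact Or.inl (d02 m hm d)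
  · exact Or.inl (d03 m hm d)
  · rcases d01 m hm (-d) with h | h | h
    · exact Or.inl (h.symm' (by simp))
    · exact Or.inr (Or.inr ⟨rfl, rfl, Or.inl (by simpa using h)⟩)
    · exact Or.inr (Or.inr ⟨rfl, rfl, Or.inr (by simpa using h)⟩)
  · exact Or.inl (pure_odd m 1 (d11 m) d (h rfl))
  · exact Or.inl ((d21 m hm (-d)).symm' (by simp))
  · exact Or.inl (d13 m hm d)
  · exact Or.inl ((d02 m hm (-d)).symm' (by simp))
  · exact Or.inl (d21 m hm d)
  · exact Or.inl (pure_even m 2 (d22 m) d (h rfl))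
  · exact Or.inl (d23 m hm d)
  · exact Or.inl ((d03 m hm (-d)).symm' (by simp))
  · exact Or.inl ((d13 m hm (-d)).symm' (by simp))
  · exact Or.inl ((d23 m hm (-d)).symm' (by simp))
  · exact Or.inl (pure_odd m 3 (d33 m) d (h rfl))

lemma inf_all (m : ℕ) (hm : 1 ≤ m) (s : Fin 4) :
    ∃ x, Cons m none (some (s, x)) ∨ Cons m (some (s, x)) none := by
  obtain ⟨l, rfl⟩ : ∃ l, m = l + 1 := ⟨m - 1, by omega⟩
  fin_cases s
  · exact ⟨_, Or.inl (Cons.last 1 1 (B2_f l) ((cB2_pat (by omega)).trans (pat0 0)))⟩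
  · exact ⟨_, Or.inr (Cons.mk 0 0 (4 * (l + 1)) (by omega) (A1_e _ hm) (A1_f _ hm))⟩
  · exact ⟨_, Or.inl (Cons.last 0 0 (A1_f _ hm) (A1_0 _))⟩
  · exact ⟨_, Or.inr (Cons.mk 1 1 (4 * l + 4) (by omega) (B2_e l) (B2_f l))⟩

/-- Cycles of the half-parallel class. -/
def HCons (m : ℕ) (u v : VV m) : Prop :=
  ∃ i : ℕ, i < 4 * m + 2 ∧ hp m i = u ∧ hp m ((i + 1) % (4 * m + 2)) = v

lemma hcons1 (m : ℕ) (x : ZMod (2 * m + 1)) : HCons m (some (0, x)) (some (1, x)) := by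
  have h1 := ZMod.val_lt x
  have h2 := ZMod.natCast_zmod_val x
  refine ⟨2 * x.val, by omega, ?_, ?_⟩
  · have : 2 * x.val / 2 = x.val := by omega
    unfold hp; rw [if_pos (by omega), this, h2]
  · have : (2 * x.val + 1) / 2 = x.val := by omega
    rw [Nat.mod_eq_of_lt (by omega)]
    unfold hp; rw [if_neg (by omega), this, h2]

lemma hcons2 (m : ℕ) (x : ZMod (2 * m + 1)) : HCons m (some (1, x)) (some (0, x + 1)) := by
  have h1 := ZMod.val_lt x
  have h2 := ZMod.natCast_zmod_val x
  refine ⟨2 * x.val + 1, by omega, ?_, ?_⟩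
  · have : (2 * x.val + 1) / 2 = x.val := by omega
    unfold hp; rw [if_neg (by omega), this, h2]
  · by_cases h : x.val = 2 * m
    · have : (2 * x.val + 1 + 1) % (4 * m + 2) = 0 := by
        rw [h]; have : 2 * (2 * m) + 1 + 1 = 4 * m + 2 := by ring
        rw [this, Nat.mod_self]
      rw [this]
      unfold hp
      rw [h] at h2
      rw [if_pos (by omega), ← h2]
      have := hn m
      push_cast
      rw [this]
    · have h3 : (2 * x.val + 1 + 1) / 2 = x.val + 1 := by omega
      rw [Nat.mod_eq_of_lt (by omega)]
      unfold hp; rw [if_pos (by omega), h3]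
      push_cast; rw [h2]

lemma hp_inj (m i j : ℕ) (hi : i < 4 * m + 2) (hj : j < 4 * m + 2) (h : hp m i = hp m j) :
    i = j := by
  unfold hp at h
  have h' := Option.some.inj h
  rw [Prod.mk.injEq] at h'
  obtain ⟨h1, h2⟩ := h'
  rw [ZMod.natCast_eq_natCast_iff', Nat.mod_eq_of_lt (by omega), Nat.mod_eq_of_lt (by omega)] at h2
  split_ifs at h1 <;> omega

/-- Covering a large set by a small domain forces injectivity. -/
lemma inj_of_cover {α β : Type*} [Fintype α] [DecidableEq β] (f : α → β) (T : Finset β)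
    (hT : ∀ t ∈ T, ∃ a, f a = t) (hc : Fintype.card α ≤ T.card) : Function.Injective f := by
  classical
  have h1 : T ⊆ Finset.univ.image f := by
    intro t ht
    obtain ⟨a, ha⟩ := hT t ht
    exact Finset.mem_image.2 ⟨a, Finset.mem_univ _, ha⟩
  have h2 : (Finset.univ.image f).card = (Finset.univ : Finset α).card :=
    le_antisymm Finset.card_image_le (by
      rw [Finset.card_univ]; exact hc.trans (Finset.card_le_card h1))
  have := Finset.card_image_iff.1 h2
  simpa using this

lemma sh_inj (m : ℕ) (g : ZMod (2 * m + 1)) : Function.Injective (sh m g) := by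
  apply Option.map_injective
  rintro ⟨a, b⟩ ⟨c, d⟩ h
  simpa using h

/-- cyclic index lemma -/
lemma val_succ (m : ℕ) (i : ℕ) (hi : i < 4 * m + 2) :
    ((i : ZMod (4 * m + 2))).val = i ∧
    ((i : ZMod (4 * m + 2)) + 1).val = (i + 1) % (4 * m + 2) := by
  refine ⟨by rw [ZMod.val_natCast, Nat.mod_eq_of_lt hi], ?_⟩
  have : (i : ZMod (4 * m + 2)) + 1 = ((i + 1 : ℕ) : ZMod (4 * m + 2)) := by push_cast; rfl
  rw [this, ZMod.val_natCast]

lemma base_inj (m : ℕ) (hm : 1 ≤ m) (c : Fin 2) :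
    Function.Injective (fun p : Fin 2 × ZMod (4 * m + 2) => base m c p.1 p.2.val) := by
  apply inj_of_cover _ (Finset.univ.erase (miss m c))
  · intro v hv
    obtain ⟨j, i, hi, h⟩ := hit_all m hm c v (Finset.ne_of_mem_erase hv)
    exact ⟨(j, (i : ZMod (4 * m + 2))), by simpa [(val_succ m i hi).1] using h⟩
  · rw [Finset.card_erase_of_mem (Finset.mem_univ _), Finset.card_univ]
    simp [ZMod.card]
    omega

/-- Index set of all cycles, with the translates. -/
abbrev Ix (m : ℕ) := ((ZMod (2 * m + 1) × Fin 2) × Fin 2) ⊕ Fin 1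

/-- All cycles. -/
def cyc (m : ℕ) : Ix m → ZMod (4 * m + 2) → VV m :=
  Sum.elim (fun q z => sh m q.1.1 (base m q.1.2 q.2 z.val)) (fun _ z => hp m z.val)

lemma cover_of_cons {m : ℕ} {u v : VV m} (g : ZMod (2 * m + 1)) (h : Cons m u v) :
    ∃ (p : Ix m) (z : ZMod (4 * m + 2)),
      s(cyc m p z, cyc m p (z + 1)) = s(sh m g u, sh m g v) := by
  obtain ⟨c, j, i, hi, rfl, rfl⟩ := h
  refine ⟨Sum.inl ((g, c), j), (i : ZMod (4 * m + 2)), ?_⟩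
  simp only [cyc, Sum.elim_inl, (val_succ m i hi).1, (val_succ m i hi).2]

lemma cover_of_hcons {m : ℕ} {u v : VV m} (h : HCons m u v) :
    ∃ (p : Ix m) (z : ZMod (4 * m + 2)), s(cyc m p z, cyc m p (z + 1)) = s(u, v) := by
  obtain ⟨i, hi, rfl, rfl⟩ := h
  refine ⟨Sum.inr 0, (i : ZMod (4 * m + 2)), ?_⟩
  simp only [cyc, Sum.elim_inr, (val_succ m i hi).1, (val_succ m i hi).2]

lemma cover_inf (m : ℕ) (hm : 1 ≤ m) (s : Fin 4) (x : ZMod (2 * m + 1)) :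
    ∃ (p : Ix m) (z : ZMod (4 * m + 2)),
      s(cyc m p z, cyc m p (z + 1)) = s(none, some (s, x)) := by
  obtain ⟨y, h | h⟩ := inf_all m hm s
  · obtain ⟨p, z, hz⟩ := cover_of_cons (x - y) h
    exact ⟨p, z, by rw [hz]; simp [sh]⟩
  · obtain ⟨p, z, hz⟩ := cover_of_cons (x - y) h
    exact ⟨p, z, by rw [hz, Sym2.eq_swap]; simp [sh]⟩

lemma cover (m : ℕ) (hm : 1 ≤ m) (u v : VV m) (huv : u ≠ v) :
    ∃ (p : Ix m) (z : ZMod (4 * m + 2)), s(cyc m p z, cyc m p (z + 1)) = s(u, v) := by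
  rcases u with _ | ⟨s, x⟩ <;> rcases v with _ | ⟨t, y⟩
  · exact absurd rfl huv
  · exact cover_inf m hm t y
  · rw [Sym2.eq_swap]; exact cover_inf m hm s x
  · rcases dif_all m hm s t (y - x) (by
      rintro rfl h; exact huv (by rw [sub_eq_zero.1 h])) with h | h | h
    · obtain ⟨w, h | h⟩ := h
      · obtain ⟨p, z, hz⟩ := cover_of_cons (x - w) h
        exact ⟨p, z, by rw [hz]; simp [sh]; left; ring⟩
      · obtain ⟨p, z, hz⟩ := cover_of_cons (x - w) h
        exact ⟨p, z, by rw [hz, Sym2.eq_swap]; simp [sh]; left; ring⟩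
    · obtain ⟨rfl, rfl, h | h⟩ := h
      · obtain rfl : y = x := sub_eq_zero.1 h
        exact cover_of_hcons (hcons1 m y)
      · obtain rfl : x = y + 1 := by linear_combination -h
        rw [Sym2.eq_swap]; exact cover_of_hcons (hcons2 m y)
    · obtain ⟨rfl, rfl, h | h⟩ := h
      · obtain rfl : y = x := sub_eq_zero.1 h
        rw [Sym2.eq_swap]; exact cover_of_hcons (hcons1 m y)
      · obtain rfl : y = x + 1 := by linear_combination h
        exact cover_of_hcons (hcons2 m x)

lemma edge_inj (m : ℕ) (hm : 1 ≤ m) : Function.Injective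
    (fun q : Ix m × ZMod (4 * m + 2) => s(cyc m q.1 q.2, cyc m q.1 (q.2 + 1))) := by
  classical
  apply inj_of_cover _ (Finset.univ.filter (fun e : Sym2 (VV m) => ¬ e.IsDiag))
  · intro e he
    induction e using Sym2.ind with
    | _ u v =>
      obtain ⟨p, z, h⟩ := cover m hm u v (by simpa using he)
      exact ⟨(p, z), h⟩
  · have h := Sym2.card_subtype_not_diag (α := VV m)
    rw [Fintype.card_subtype] at h
    rw [h]
    simp only [Fintype.card_prod, Fintype.card_sum, Fintype.card_option, ZMod.card,
      Fintype.card_fin]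
    rw [Nat.choose_two_right, Nat.le_div_iff_mul_le (by norm_num)]
    apply le_of_eq
    simp only [Nat.add_sub_cancel]
    ring

end ARCS

/-- For every `k ≥ 6` with `k ≡ 2 (mod 4)`, there exists an almost resolvable
`k`-cycle system of order `2k+1`. -/
theorem arcs_two_k_plus_one_all (k : ℕ) (hk : 6 ≤ k) (hk4 : k % 4 = 2) :
    HasARCS k (2 * k + 1) := by
  obtain ⟨m, rfl⟩ : ∃ m, k = 4 * m + 2 := ⟨k / 4, by omega⟩
  have hm : 1 ≤ m := by omega
  have e1 : (2 * (4 * m + 2) + 1 - 1) / 2 = 4 * m + 2 := by omega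
  have e2 : (2 * (4 * m + 2) + 1 - 1) / (4 * m + 2) = 2 := by
    rw [Nat.add_sub_cancel]; exact Nat.mul_div_cancel _ (by omega)
  have e3 : (2 * (4 * m + 2) + 1 - 1) / (2 * (4 * m + 2)) = 1 := by
    rw [Nat.add_sub_cancel]; exact Nat.div_self (by omega)
  unfold HasARCS
  rw [e1, e2, e3]
  have eI : Fin (4 * m + 2) ≃ ZMod (2 * m + 1) × Fin 2 := Fintype.equivOfCardEq (by
    simp only [Fintype.card_prod, ZMod.card, Fintype.card_fin]; ring)
  have eV : ARCS.VV m ≃ Fin (2 * (4 * m + 2) + 1) := Fintype.equivOfCardEq (by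
    simp only [Fintype.card_prod, ZMod.card, Fintype.card_fin, Fintype.card_option]; ring)
  refine ⟨fun i j z => eV (ARCS.cyc m (Sum.inl (eI i, j)) z),
    fun j z => eV (ARCS.cyc m (Sum.inr j) z), ?_, ?_, ?_, ?_, ?_⟩
  · intro i j z w h
    have h1 := ARCS.sh_inj m _ (eV.injective h)
    have h2 := ARCS.base_inj m hm _ (a₁ := (j, z)) (a₂ := (j, w)) h1
    exact (Prod.mk.inj h2).2
  · intro j z w h
    have h1 := ARCS.hp_inj m _ _ (ZMod.val_lt z) (ZMod.val_lt w) (eV.injective h)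
    exact ZMod.val_injective _ h1
  · intro i j₁ j₂ hj
    rw [Set.disjoint_left]
    rintro _ ⟨z, rfl⟩ ⟨w, h⟩
    have h1 := ARCS.sh_inj m _ (eV.injective h)
    have h2 := ARCS.base_inj m hm _ (a₁ := (j₂, w)) (a₂ := (j₁, z)) h1
    exact hj (Prod.mk.inj h2).1.symm
  · intro j₁ j₂ hj
    exact absurd (Subsingleton.elim _ _) hj
  · intro e he
    induction e using Sym2.ind with
    | _ u v =>
      have huv : u ≠ v := by simpa using he
      -- membership in terms of `cyc`
      have key : ∀ p : (Fin (4 * m + 2) × Fin 2) ⊕ Fin 1,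
          s(u, v) ∈ Sum.elim
            (fun q : Fin (4 * m + 2) × Fin 2 =>
              cycleEdgeSet (fun z => eV (ARCS.cyc m (Sum.inl (eI q.1, q.2)) z)))
            (fun j => cycleEdgeSet (fun z => eV (ARCS.cyc m (Sum.inr j) z))) p ↔
          ∃ z, s(eV.symm u, eV.symm v) =
            s(ARCS.cyc m (Sum.map (Prod.map eI id) id p) z,
              ARCS.cyc m (Sum.map (Prod.map eI id) id p) (z + 1)) := by
        have aux : ∀ x y : ARCS.VV m, s(u, v) = s(eV x, eV y) ↔
            s(eV.symm u, eV.symm v) = s(x, y) := by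
          intro x y
          simp only [Sym2.eq_iff, Equiv.symm_apply_eq]
        rintro (q | j)
        · exact exists_congr fun z => aux _ _
        · exact exists_congr fun z => aux _ _
      have hinj : Function.Injective (Sum.map (Prod.map eI id) id :
          (Fin (4 * m + 2) × Fin 2) ⊕ Fin 1 → ARCS.Ix m) :=
        Sum.map_injective.2 ⟨Prod.map_injective.2 ⟨eI.injective, Function.injective_id⟩,
          Function.injective_id⟩
      obtain ⟨p, z, hz⟩ := ARCS.cover m hm (eV.symm u) (eV.symm v)
        (fun h => huv (eV.symm.injective h))
      obtain ⟨p', hp'⟩ : ∃ p', Sum.map (Prod.map eI id) id p' = p := by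
        rcases p with ⟨q, j⟩ | j
        · exact ⟨Sum.inl (eI.symm q, j), by simp⟩
        · exact ⟨Sum.inr j, by simp⟩
      refine ⟨p', (key p').2 ⟨z, by rw [hp', hz]⟩, ?_⟩
      intro r hr
      obtain ⟨w, hw⟩ := (key r).1 hr
      apply hinj
      rw [hp']
      have := ARCS.edge_inj m hm (a₁ := (_, w)) (a₂ := (p, z)) (hw.symm.trans hz.symm)
      exact (Prod.mk.inj this).1
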